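/- Let d ≥ 1, m > 0, and let f ∈ L¹(ℝ^{2d}) be a nonnegative probability density whose distributional p-gradient ∇_p f belongs to L¹_loc(ℝ^{2d}). Assume that the function v := (∇_p f / f)·1_{{f>0}} + p/m belongs to L²(f dq dp), i.e. ∫ |v|² f < ∞. Then separately (∇_p f / f)·1_{{f>0}} ∈ L²(f dq dp) and p/m ∈ L²(f dq dp); more precisely, ∫_{ℝ^{2d}} ( |(∇_p f/f)·1_{{f>0}}|² + |p/m|² ) f dq dp ≤ ∫_{ℝ^{2d}} |v|² f dq dp + 2d/m. -/

import Mathlib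

open MeasureTheory Real Filter Topology Set
open scoped ENNReal NNReal

noncomputable section

/-- Phase space ℝ^{2d} = ℝ^d_q × ℝ^d_p. -/
abbrev Phase (d : ℕ) := (Fin d → ℝ) × (Fin d → ℝ)

/-- The unit direction in the `p_i` coordinate. -/
def dirP {d : ℕ} (i : Fin d) : Phase d := (0, Pi.single i 1)

/-- Partial derivative in the `p_i` variable. -/
def pdP {d : ℕ} (φ : Phase d → ℝ) (x : Phase d) (i : Fin d) : ℝ :=
  fderiv ℝ φ x (dirP i)

/-- `φ ∈ C_c^∞(ℝ^{2d})`. -/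
def IsTestFn {d : ℕ} (φ : Phase d → ℝ) : Prop :=
  ContDiff ℝ (⊤ : ℕ∞) φ ∧ HasCompactSupport φ

/-- `G` is the distributional gradient of `f` in the `p`-variables, with `G ∈ L¹_loc`. -/
def IsWeakPGrad {d : ℕ} (f : Phase d → ℝ) (G : Phase d → Fin d → ℝ) : Prop :=
  (∀ i, LocallyIntegrable (fun x => G x i) volume) ∧
  ∀ φ : Phase d → ℝ, IsTestFn φ → ∀ i,
    ∫ x, f x * pdP φ x i = - ∫ x, G x i * φ x

section WeakDirectionalDerivative

open scoped ContDiff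

variable {E : Type*} [NormedAddCommGroup E] [NormedSpace ℝ E]
  [MeasurableSpace E] [BorelSpace E] {μ : Measure E}
  {f g : E → ℝ} {e : E}

/-- The fundamental theorem of calculus along a direction, tested against a smooth function. -/
lemma integral_mul_translate_sub_of_weak_deriv (hf : Integrable f μ)
    (hw : ∀ φ : E → ℝ, ContDiff ℝ ∞ φ → HasCompactSupport φ →
      ∫ x, f x * fderiv ℝ φ x e ∂μ = - ∫ x, g x * φ x ∂μ)
    {φ : E → ℝ} (hφ : ContDiff ℝ ∞ φ) (hφc : HasCompactSupport φ) (h : ℝ) :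
    ∫ s in (0 : ℝ)..h, ∫ x, g x * φ (x - s • e) ∂μ
      = ∫ x, f x * φ (x - h • e) ∂μ - ∫ x, f x * φ x ∂μ := by
  have hφd : Continuous fun x => fderiv ℝ φ x e :=
    (hφ.continuous_fderiv (by simp)).clm_apply continuous_const
  obtain ⟨C, hC⟩ := (hφc.fderiv_apply (𝕜 := ℝ) e).exists_bound_of_continuous hφd
  obtain ⟨C₀, hC₀⟩ := hφc.exists_bound_of_continuous hφ.continuous
  have hφt : ∀ s : ℝ, ContDiff ℝ ∞ fun x => φ (x - s • e) := fun s =>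
    hφ.comp (contDiff_id.sub contDiff_const)
  have hφtc : ∀ s : ℝ, HasCompactSupport fun x => φ (x - s • e) := fun s =>
    hφc.comp_homeomorph (Homeomorph.subRight (s • e))
  have hfd : ∀ (s : ℝ) x, fderiv ℝ (fun x => φ (x - s • e)) x e = fderiv ℝ φ (x - s • e) e := by
    intro s x
    simpa [sub_eq_add_neg] using congrArg (· e)
      (fderiv_comp_add_right (𝕜 := ℝ) (f := φ) (x := x) (-(s • e)))
  have hgφ : ∀ s : ℝ, ∫ x, g x * φ (x - s • e) ∂μ = ∫ x, f x * -fderiv ℝ φ (x - s • e) e ∂μ := by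
    intro s
    have := hw _ (hφt s) (hφtc s)
    simp only [hfd] at this
    simp only [mul_neg, integral_neg, this, neg_neg]
  have hmeas : ∀ s : ℝ, AEStronglyMeasurable (fun x => f x * -fderiv ℝ φ (x - s • e) e) μ :=
    fun s => hf.1.mul ((hφd.comp (continuous_id.sub continuous_const)).neg.aestronglyMeasurable)
  have hbd : ∀ (s : ℝ) x, ‖f x * -fderiv ℝ φ (x - s • e) e‖ ≤ ‖f x‖ * C := fun s x => by
    rw [norm_mul, norm_neg]
    exact mul_le_mul_of_nonneg_left (hC _) (norm_nonneg _)
  have hcont : Continuous fun s : ℝ => ∫ x, g x * φ (x - s • e) ∂μ := by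
    simp only [hgφ]
    refine continuous_of_dominated hmeas (fun s => ae_of_all _ (hbd s)) (hf.norm.mul_const C)
      (ae_of_all _ fun x => ?_)
    exact continuous_const.mul (hφd.comp (by fun_prop)).neg
  have hderiv : ∀ s : ℝ, HasDerivAt (fun s : ℝ => ∫ x, f x * φ (x - s • e) ∂μ)
      (∫ x, g x * φ (x - s • e) ∂μ) s := by
    intro s
    rw [hgφ]
    have hFm : ∀ s : ℝ, AEStronglyMeasurable (fun x => f x * φ (x - s • e)) μ :=
      fun s => hf.1.mul (hφt s).continuous.aestronglyMeasurable
    refine (hasDerivAt_integral_of_dominated_loc_of_deriv_le (s := univ)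
      (bound := fun x => ‖f x‖ * C)
      (F' := fun (s : ℝ) x => f x * -fderiv ℝ φ (x - s • e) e) univ_mem
      (Eventually.of_forall hFm) ?_ (hmeas s) (ae_of_all _ fun x t _ => hbd t x)
      (hf.norm.mul_const C) (ae_of_all _ fun x t _ => ?_)).2
    · exact (hf.norm.mul_const C₀).mono' (hFm s) (ae_of_all _ fun x => by
        rw [norm_mul]
        exact mul_le_mul_of_nonneg_left (hC₀ _) (norm_nonneg _))
    · refine HasDerivAt.const_mul _ ?_
      have h1 : HasDerivAt (fun t : ℝ => x - t • e) (-e) t := by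
        simpa using ((hasDerivAt_id t).smul_const e).const_sub x
      have h2 := ((hφ.differentiable (by simp)) (x - t • e)).hasFDerivAt.comp_hasDerivAt t h1
      simpa [Function.comp_def] using h2
  rw [intervalIntegral.integral_eq_sub_of_hasDerivAt (fun s _ => hderiv s)
    (hcont.intervalIntegrable _ _)]
  simp

variable [FiniteDimensional ℝ E] [μ.IsAddHaarMeasure]

/-- The translates `x ↦ g (x + s • e)`, as a function of `(s, x)`, are jointly integrable for `s`
in a set of finite measure. -/
lemma integrable_uncurry_translate (hg : Integrable g μ) (e : E) (ν : Measure ℝ)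
    [IsFiniteMeasure ν] :
    Integrable (Function.uncurry fun (s : ℝ) x => g (x + s • e)) (ν.prod μ) := by
  have hmp : MeasurePreserving (fun z : ℝ × E => (z.1, z.2 + z.1 • e)) (ν.prod μ) (ν.prod μ) := by
    refine MeasurePreserving.skew_product (f := id) (g := fun (s : ℝ) x => x + s • e)
      (MeasurePreserving.id ν) (by unfold Function.uncurry; fun_prop) (ae_of_all _ fun s => ?_)
    exact map_add_right_eq_self μ (s • e)
  exact hmp.integrable_comp_of_integrable (hg.comp_snd ν)

/-- Translation is continuous in `L¹`, tested against a set. -/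
lemma continuous_setIntegral_translate (hg : Integrable g μ) (e : E) (T : Set E) :
    Continuous fun s : ℝ => ∫ x in T, g (x + s • e) ∂μ := by
  let γ : ℝ → C(E, E) := fun s => ⟨fun x => x + s • e, by fun_prop⟩
  have hγ : Continuous γ :=
    ContinuousMap.continuous_of_continuous_uncurry _ (by
      change Continuous fun z : ℝ × E => z.2 + z.1 • e
      fun_prop)
  have hmp : ∀ s, MeasurePreserving (γ s) μ μ := fun s => measurePreserving_add_right μ (s • e)
  have hg1 : MemLp g 1 μ := memLp_one_iff_integrable.2 hg
  have : Fact ((1 : ℝ≥0∞) ≤ 1) := ⟨le_rfl⟩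
  have hc := (continuous_setIntegral T).comp (Continuous.compMeasurePreservingLp
    (f := fun _ : ℝ => hg1.toLp g) continuous_const hγ hmp ENNReal.one_ne_top)
  refine hc.congr fun s => ?_
  refine integral_congr_ae (ae_restrict_of_ae ?_)
  exact ((hg1.comp_measurePreserving (hmp s)).coeFn_toLp)

/-- The fundamental theorem of calculus along a direction, integrated over a set. -/
lemma setIntegral_translate_sub_of_weak_deriv (hf : Integrable f μ) (hg : Integrable g μ)
    (hw : ∀ φ : E → ℝ, ContDiff ℝ ∞ φ → HasCompactSupport φ →
      ∫ x, f x * fderiv ℝ φ x e ∂μ = - ∫ x, g x * φ x ∂μ) (T : Set E) (h : ℝ) :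
    ∫ s in (0 : ℝ)..h, ∫ x in T, g (x + s • e) ∂μ
      = ∫ x in T, f (x + h • e) ∂μ - ∫ x in T, f x ∂μ := by
  have hfin : IsFiniteMeasure (volume.restrict (uIoc 0 h)) :=
    ⟨by simp [uIoc]⟩
  have hprod := integrable_uncurry_translate hg e (volume.restrict (uIoc 0 h))
  have hfh : Integrable (fun x => f (x + h • e)) μ := hf.comp_add_right _
  have hI : Integrable (fun x => ∫ s in (0 : ℝ)..h, g (x + s • e)) μ := by
    simp only [intervalIntegral.intervalIntegral_eq_integral_uIoc]
    exact hprod.integral_prod_right.smul (if 0 ≤ h then (1 : ℝ) else -1)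
  have hae : ∀ᵐ x ∂μ, f (x + h • e) - f x - ∫ s in (0 : ℝ)..h, g (x + s • e) = 0 := by
    refine ae_eq_zero_of_integral_contDiff_smul_eq_zero
      ((hfh.sub hf).sub hI).locallyIntegrable fun φ hφ hφc => ?_
    obtain ⟨C₀, hC₀⟩ := hφc.exists_bound_of_continuous hφ.continuous
    have hm : ∀ {u : E → ℝ}, Integrable u μ → Integrable (fun x => φ x * u x) μ := fun hu =>
      hu.bdd_mul hφ.continuous.aestronglyMeasurable (ae_of_all _ hC₀)
    have h1 : ∫ x, φ x * f (x + h • e) ∂μ = ∫ x, f x * φ (x - h • e) ∂μ := by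
      rw [← integral_add_right_eq_self (μ := μ) (fun x => f x * φ (x - h • e)) (h • e)]
      simp [mul_comm]
    have h2 : ∀ s : ℝ, ∫ x, φ x * g (x + s • e) ∂μ = ∫ x, g x * φ (x - s • e) ∂μ := by
      intro s
      rw [← integral_add_right_eq_self (μ := μ) (fun x => g x * φ (x - s • e)) (s • e)]
      simp [mul_comm]
    have h3 : ∫ x, φ x * (∫ s in (0 : ℝ)..h, g (x + s • e)) ∂μ
        = ∫ s in (0 : ℝ)..h, ∫ x, g x * φ (x - s • e) ∂μ := by
      simp only [← intervalIntegral.integral_const_mul, ← h2]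
      rw [intervalIntegral_integral_swap]
      exact hprod.bdd_mul (c := C₀) (hφ.continuous.comp continuous_snd).aestronglyMeasurable
        (ae_of_all _ fun z => hC₀ z.2)
    simp only [smul_eq_mul, mul_sub]
    rw [integral_sub (f := fun x => φ x * f (x + h • e) - φ x * f x) ((hm hfh).sub (hm hf))
      (hm hI), integral_sub (hm hfh) (hm hf), h1, h3,
      integral_mul_translate_sub_of_weak_deriv hf hw hφ hφc h]
    simp [mul_comm]
  have hT : Integrable (Function.uncurry fun (s : ℝ) x => g (x + s • e))
      ((volume.restrict (uIoc 0 h)).prod (μ.restrict T)) :=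
    hprod.mono_measure (Measure.prod_mono le_rfl Measure.restrict_le_self)
  rw [intervalIntegral_integral_swap hT, ← integral_sub hfh.integrableOn hf.integrableOn]
  refine integral_congr_ae (ae_restrict_of_ae ?_)
  filter_upwards [hae] with x hx
  linarith

/-- The weak directional derivative of a nonnegative integrable function vanishes almost everywhere
on the zero set of the function. -/
lemma weak_deriv_ae_eq_zero_of_eq_zero (hf : Integrable f μ) (hf0 : ∀ x, 0 ≤ f x)
    (hg : Integrable g μ)
    (hw : ∀ φ : E → ℝ, ContDiff ℝ ∞ φ → HasCompactSupport φ →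
      ∫ x, f x * fderiv ℝ φ x e ∂μ = - ∫ x, g x * φ x ∂μ) :
    ∀ᵐ x ∂μ, f x = 0 → g x = 0 := by
  refine ae_imp_of_ae_restrict (s := {x | f x = 0}) ?_
  refine Integrable.ae_eq_zero_of_forall_setIntegral_eq_zero hg.integrableOn fun S hS _ => ?_
  rw [Measure.restrict_restrict hS]
  set T := S ∩ {x | f x = 0}
  have hk := continuous_setIntegral_translate hg e T
  have hd : HasDerivAt (fun h : ℝ => ∫ s in (0 : ℝ)..h, ∫ x in T, g (x + s • e) ∂μ)
      (∫ x in T, g (x + (0 : ℝ) • e) ∂μ) 0 :=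
    intervalIntegral.integral_hasDerivAt_right (hk.intervalIntegrable _ _)
      hk.aestronglyMeasurable.stronglyMeasurableAtFilter hk.continuousAt
  have hfT : ∫ x in T, f x ∂μ = 0 := setIntegral_eq_zero_of_forall_eq_zero fun x hx => hx.2
  have hmin : IsLocalMin (fun h : ℝ => ∫ s in (0 : ℝ)..h, ∫ x in T, g (x + s • e) ∂μ) 0 := by
    refine Eventually.of_forall fun h => ?_
    simp only [intervalIntegral.integral_same, setIntegral_translate_sub_of_weak_deriv hf hg hw,
      hfT, sub_zero]
    exact integral_nonneg fun x => hf0 _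
  simpa using hmin.hasDerivAt_eq_zero hd

end WeakDirectionalDerivative

section Cutoff

open scoped ContDiff

variable {d : ℕ}

lemma pdP_mul {φ ψ : Phase d → ℝ} {x : Phase d} (hφ : DifferentiableAt ℝ φ x)
    (hψ : DifferentiableAt ℝ ψ x) (i : Fin d) :
    pdP (fun y => φ y * ψ y) x i = φ x * pdP ψ x i + ψ x * pdP φ x i := by
  simp [pdP, fderiv_fun_mul hφ hψ]

lemma pdP_momentum (x : Phase d) (i : Fin d) : pdP (fun y => y.2 i) x i = 1 := by
  let L : Phase d →L[ℝ] ℝ :=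
    (ContinuousLinearMap.proj i).comp (ContinuousLinearMap.snd ℝ (Fin d → ℝ) (Fin d → ℝ))
  have : pdP (fun y => y.2 i) x i = L (dirP i) := by
    change fderiv ℝ L x (dirP i) = _
    rw [L.fderiv]
  simp [this, L, dirP]

lemma IsTestFn.differentiable {φ : Phase d → ℝ} (hφ : IsTestFn φ) : Differentiable ℝ φ :=
  hφ.1.differentiable (by simp)

lemma IsTestFn.mul {φ ψ : Phase d → ℝ} (hφ : IsTestFn φ) (hψ : ContDiff ℝ ∞ ψ) :
    IsTestFn fun x => φ x * ψ x :=
  ⟨hφ.1.mul hψ, hφ.2.mul_right⟩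

lemma IsTestFn.continuous_pdP {φ : Phase d → ℝ} (hφ : IsTestFn φ) (i : Fin d) :
    Continuous fun x => pdP φ x i :=
  (hφ.1.continuous_fderiv (by simp)).clm_apply continuous_const

lemma IsTestFn.hasCompactSupport_pdP {φ : Phase d → ℝ} (hφ : IsTestFn φ) (i : Fin d) :
    HasCompactSupport fun x => pdP φ x i :=
  hφ.2.fderiv_apply (𝕜 := ℝ) (dirP i)

/-- A smooth cutoff on phase space equal to `1` on the unit ball. -/
def phaseBump (d : ℕ) : ContDiffBump (0 : Phase d) := ⟨1, 2, one_pos, one_lt_two⟩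

/-- The dilates `x ↦ χ (x / (n + 1))` of a fixed smooth cutoff `χ`. -/
def cutoff (n : ℕ) (x : Phase d) : ℝ := phaseBump d (((n : ℝ) + 1)⁻¹ • x)

lemma isTestFn_phaseBump : IsTestFn (phaseBump d) :=
  ⟨(phaseBump d).contDiff, (phaseBump d).hasCompactSupport⟩

lemma isTestFn_cutoff (n : ℕ) : IsTestFn (cutoff n : Phase d → ℝ) :=
  ⟨(phaseBump d).contDiff.comp (contDiff_const_smul _),
    (phaseBump d).hasCompactSupport.comp_smul (by positivity)⟩

lemma cutoff_nonneg (n : ℕ) (x : Phase d) : 0 ≤ cutoff n x := (phaseBump d).nonneg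

lemma cutoff_le_one (n : ℕ) (x : Phase d) : cutoff n x ≤ 1 := (phaseBump d).le_one

lemma tendsto_inv_smul_zero (x : Phase d) :
    Tendsto (fun n : ℕ => ((n : ℝ) + 1)⁻¹ • x) atTop (𝓝 0) := by
  have h := (tendsto_one_div_add_atTop_nhds_zero_nat (𝕜 := ℝ)).smul_const x
  simpa only [one_div, zero_smul] using h

lemma tendsto_cutoff (x : Phase d) : Tendsto (fun n => cutoff n x) atTop (𝓝 1) := by
  have h := ((phaseBump d).continuous.tendsto 0).comp (tendsto_inv_smul_zero x)
  rwa [(phaseBump d).one_of_mem_closedBall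
    (Metric.mem_closedBall_self (phaseBump d).rIn_pos.le)] at h

lemma pdP_cutoff (n : ℕ) (x : Phase d) (i : Fin d) :
    pdP (cutoff n) x i = ((n : ℝ) + 1)⁻¹ * pdP (phaseBump d) (((n : ℝ) + 1)⁻¹ • x) i := by
  have h := fderiv_comp_smul (𝕜 := ℝ) (f := phaseBump d) (x := x) (((n : ℝ) + 1)⁻¹)
  change fderiv ℝ (fun y => phaseBump d (((n : ℝ) + 1)⁻¹ • y)) x (dirP i) = _
  rw [h]
  rfl

/-- The cutoff error `∫ f p_i ∂_{p_i} χ_n` tends to zero. -/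
lemma tendsto_integral_mul_momentum_mul_pdP_cutoff {f : Phase d → ℝ} (hf : Integrable f volume)
    (i : Fin d) :
    Tendsto (fun n => ∫ x, f x * (x.2 i * pdP (cutoff n) x i)) atTop (𝓝 0) := by
  let Ψ : Phase d → ℝ := fun y => y.2 i * pdP (phaseBump d) y i
  have hΨ : Continuous Ψ :=
    ((continuous_apply i).comp continuous_snd).mul (isTestFn_phaseBump.continuous_pdP i)
  obtain ⟨C, hC⟩ := ((isTestFn_phaseBump (d := d)).hasCompactSupport_pdP i).mul_left
    (f := fun y : Phase d => y.2 i) |>.exists_bound_of_continuous hΨ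
  have hrw : ∀ (n : ℕ) (x : Phase d),
      x.2 i * pdP (cutoff n) x i = Ψ (((n : ℝ) + 1)⁻¹ • x) := fun n x => by
    simp only [pdP_cutoff, Ψ, Prod.smul_snd, Pi.smul_apply, smul_eq_mul]
    ring
  simp only [hrw]
  rw [← integral_zero (Phase d) ℝ]
  refine tendsto_integral_of_dominated_convergence (fun x => ‖f x‖ * C) (fun n => ?_)
    (hf.norm.mul_const C) (fun n => ae_of_all _ fun x => ?_) (ae_of_all _ fun x => ?_)
  · exact hf.1.mul (hΨ.comp (continuous_const_smul _)).aestronglyMeasurable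
  · rw [norm_mul]
    exact mul_le_mul_of_nonneg_left (hC _) (norm_nonneg _)
  · have h := (((hΨ.tendsto 0).comp (tendsto_inv_smul_zero x)).const_mul (f x))
    simpa [Ψ] using h

end Cutoff

section WeakPGrad

variable {d : ℕ} {f : Phase d → ℝ} {G : Phase d → Fin d → ℝ}

lemma IsWeakPGrad.integrable_mul (hG : IsWeakPGrad f G) {φ : Phase d → ℝ} (hφ : Continuous φ)
    (hφc : HasCompactSupport φ) (i : Fin d) : Integrable (fun x => G x i * φ x) volume := by
  simpa only [smul_eq_mul, mul_comm] using
    (hG.1 i).integrable_smul_left_of_hasCompactSupport hφ hφc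

/-- The weak gradient of a nonnegative function vanishes almost everywhere on its zero set. -/
lemma IsWeakPGrad.ae_eq_zero_of_eq_zero (hG : IsWeakPGrad f G) (hf : Integrable f volume)
    (hf0 : ∀ x, 0 ≤ f x) (i : Fin d) : ∀ᵐ x, f x = 0 → G x i = 0 := by
  have hmul : ∀ {φ : Phase d → ℝ}, Continuous φ → HasCompactSupport φ →
      Integrable (fun x => f x * φ x) volume := fun {φ} hφ hφc => by
    obtain ⟨C, hC⟩ := hφc.exists_bound_of_continuous hφ
    exact hf.mul_bdd (c := C) hφ.aestronglyMeasurable (ae_of_all _ hC)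
  have hcut : ∀ n : ℕ, ∀ᵐ x, f x * cutoff n x = 0 →
      G x i * cutoff n x + f x * pdP (cutoff n) x i = 0 := by
    intro n
    have hη := isTestFn_cutoff (d := d) n
    have : (volume : Measure (Phase d)).IsAddHaarMeasure :=
      Measure.prod.instIsAddHaarMeasure volume volume
    refine weak_deriv_ae_eq_zero_of_eq_zero (e := dirP i) (hmul hη.1.continuous hη.2)
      (fun x => mul_nonneg (hf0 x) (cutoff_nonneg n x))
      ((hG.integrable_mul hη.1.continuous hη.2 i).add
        (hmul (hη.continuous_pdP i) (hη.hasCompactSupport_pdP i))) fun φ hφ hφc => ?_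
    have hφt : IsTestFn φ := ⟨hφ, hφc⟩
    have hηφ := hη.mul hφ
    have h1 : Integrable (fun x => f x * (cutoff n x * pdP φ x i)) volume :=
      hmul (hη.1.continuous.mul (hφt.continuous_pdP i)) (hη.2.mul_right)
    have h2 : Integrable (fun x => f x * (φ x * pdP (cutoff n) x i)) volume :=
      hmul (hφ.continuous.mul (hη.continuous_pdP i)) (hφc.mul_right)
    have h3 := hG.integrable_mul hηφ.1.continuous hηφ.2 i
    have h := hG.2 _ hηφ i
    simp only [pdP_mul (hη.differentiable _) (hφt.differentiable _), mul_add] at h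
    rw [integral_add h1 h2] at h
    have h4 : ∫ x, (G x i * cutoff n x + f x * pdP (cutoff n) x i) * φ x
        = (∫ x, G x i * (cutoff n x * φ x)) + ∫ x, f x * (φ x * pdP (cutoff n) x i) := by
      rw [← integral_add h3 h2]
      exact integral_congr_ae (ae_of_all _ fun x => by ring)
    have h5 : ∫ x, f x * cutoff n x * fderiv ℝ φ x (dirP i)
        = ∫ x, f x * (cutoff n x * pdP φ x i) :=
      integral_congr_ae (ae_of_all _ fun x => by simp only [pdP]; ring)
    change _ = -∫ x, (G x i * cutoff n x + f x * pdP (cutoff n) x i) * φ x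
    rw [h4, h5]
    linarith
  filter_upwards [ae_all_iff.2 hcut] with x hx hfx
  obtain ⟨n, hn⟩ := ((tendsto_cutoff x).eventually (lt_mem_nhds one_half_lt_one)).exists
  have h := hx n (by simp [hfx])
  have hn0 : cutoff n x ≠ 0 := (one_half_pos.trans hn).ne'
  simpa [hfx, hn0] using h

/-- Integration by parts against the truncated momentum `χ_n p_i`. -/
lemma IsWeakPGrad.neg_integral_mul_cutoff_mul_momentum_le (hG : IsWeakPGrad f G)
    (hf : Integrable f volume) (hf0 : ∀ x, 0 ≤ f x) (hf1 : ∫ x, f x = 1) (n : ℕ) (i : Fin d) :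
    -∫ x, G x i * (cutoff n x * x.2 i) ≤ 1 + ∫ x, f x * (x.2 i * pdP (cutoff n) x i) := by
  have hη := isTestFn_cutoff (d := d) n
  have hp : ContDiff ℝ (⊤ : ℕ∞) fun x : Phase d => x.2 i :=
    (contDiff_apply ℝ ℝ i).comp contDiff_snd
  have hpd : Differentiable ℝ fun x : Phase d => x.2 i := hp.differentiable (by simp)
  have hcut : Integrable (fun x => f x * cutoff n x) volume :=
    hf.mul_bdd (c := 1) hη.1.continuous.aestronglyMeasurable (ae_of_all _ fun x => by
      rw [Real.norm_of_nonneg (cutoff_nonneg n x)]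
      exact cutoff_le_one n x)
  have hψ : Continuous fun x : Phase d => x.2 i * pdP (cutoff n) x i :=
    hp.continuous.mul (hη.continuous_pdP i)
  obtain ⟨C, hC⟩ := ((hη.hasCompactSupport_pdP i).mul_left
    (f := fun y : Phase d => y.2 i)).exists_bound_of_continuous hψ
  have hrest : Integrable (fun x => f x * (x.2 i * pdP (cutoff n) x i)) volume :=
    hf.mul_bdd (c := C) hψ.aestronglyMeasurable (ae_of_all _ hC)
  have h := hG.2 _ (hη.mul hp) i
  simp only [pdP_mul (hη.differentiable _) (hpd _), pdP_momentum, mul_one, mul_add] at h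
  rw [integral_add hcut hrest] at h
  have hle : ∫ x, f x * cutoff n x ≤ 1 := by
    rw [← hf1]
    exact integral_mono hcut hf fun x => mul_le_of_le_one_right (hf0 x) (cutoff_le_one n x)
  linarith

end WeakPGrad

/-- Lemma A.1: let `f` be a nonnegative probability density on ℝ^{2d}
with distributional `p`-gradient `G = ∇_p f ∈ L¹_loc`, and suppose
`v = (∇_p f/f)·1_{f>0} + p/m ∈ L²(f dq dp)`. Then separately
`(∇_p f/f)·1_{f>0} ∈ L²(f)` and `p/m ∈ L²(f)`, with
`∫(|(∇_pf/f)1_{f>0}|² + |p/m|²) f ≤ ∫|v|² f + 2d/m`. -/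
theorem stmt13 {d : ℕ} (hd : 1 ≤ d) {m : ℝ} (hm : 0 < m)
    (f : Phase d → ℝ) (hf_int : Integrable f volume) (hf_nonneg : ∀ x, 0 ≤ f x)
    (hf_prob : ∫ x, f x = 1)
    (G : Phase d → Fin d → ℝ) (hG : IsWeakPGrad f G)
    (hv : ∫⁻ x, ENNReal.ofReal
        ((∑ i, (({y : Phase d | 0 < f y}.indicator (fun y => G y i / f y) x)
            + x.2 i / m) ^ 2) * f x) ∂volume ≠ ⊤) :
    ∫⁻ x, ENNReal.ofReal
        (((∑ i, (({y : Phase d | 0 < f y}.indicator (fun y => G y i / f y) x)) ^ 2)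
          + ∑ i, (x.2 i / m) ^ 2) * f x) ∂volume
      ≤ (∫⁻ x, ENNReal.ofReal
          ((∑ i, (({y : Phase d | 0 < f y}.indicator (fun y => G y i / f y) x)
              + x.2 i / m) ^ 2) * f x) ∂volume)
        + ENNReal.ofReal (2 * d / m) := by
  set A : Phase d → Fin d → ℝ := fun x i =>
    {y : Phase d | 0 < f y}.indicator (fun y => G y i / f y) x with hA
  have hA_eq : ∀ x i, A x i = G x i / f x := fun x i => by
    by_cases hx : 0 < f x
    · simp [hA, hx]
    · simp [hA, le_antisymm (not_lt.1 hx) (hf_nonneg x)]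
  have hGm : ∀ i, AEStronglyMeasurable (fun x => G x i) volume := fun i =>
    (hG.1 i).aestronglyMeasurable
  have hAm : ∀ i, AEMeasurable (fun x => A x i) volume := fun i => by
    simp only [hA_eq]
    exact (hGm i).aemeasurable.div hf_int.1.aemeasurable
  have hpm : ∀ i, AEMeasurable (fun x : Phase d => x.2 i / m) volume := fun i => by fun_prop
  set V : Phase d → ℝ := fun x => (∑ i, (A x i + x.2 i / m) ^ 2) * f x with hV
  set S : Phase d → ℝ := fun x => ((∑ i, A x i ^ 2) + ∑ i, (x.2 i / m) ^ 2) * f x with hS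
  have hV0 : ∀ x, 0 ≤ V x := fun x =>
    mul_nonneg (Finset.sum_nonneg fun i _ => sq_nonneg _) (hf_nonneg x)
  have hS0 : ∀ x, 0 ≤ S x := fun x =>
    mul_nonneg (add_nonneg (Finset.sum_nonneg fun i _ => sq_nonneg _)
      (Finset.sum_nonneg fun i _ => sq_nonneg _)) (hf_nonneg x)
  have hSm : AEMeasurable S volume :=
    ((Finset.aemeasurable_fun_sum _ fun i _ => (hAm i).pow_const 2).add
      (Finset.aemeasurable_fun_sum _ fun i _ => (hpm i).pow_const 2)).mul hf_int.1.aemeasurable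
  have hVm : AEMeasurable V volume :=
    (Finset.aemeasurable_fun_sum _ fun i _ => ((hAm i).add (hpm i)).pow_const 2).mul
      hf_int.1.aemeasurable
  have hVint : Integrable V volume :=
    (lintegral_ofReal_ne_top_iff_integrable hVm.aestronglyMeasurable (ae_of_all _ hV0)).1 hv
  have hcm : ∀ n, Continuous (cutoff n : Phase d → ℝ) := fun n => (isTestFn_cutoff n).1.continuous
  have hcVint : ∀ n, Integrable (fun x => cutoff n x * V x) volume := fun n =>
    hVint.bdd_mul (c := 1) (hcm n).aestronglyMeasurable (ae_of_all _ fun x => by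
      rw [Real.norm_of_nonneg (cutoff_nonneg n x)]
      exact cutoff_le_one n x)
  have hGint : ∀ n i, Integrable (fun x => G x i * (cutoff n x * x.2 i)) volume := fun n i =>
    hG.integrable_mul ((hcm n).mul ((continuous_apply i).comp continuous_snd))
      (isTestFn_cutoff n).2.mul_right i
  have hAf : ∀ᵐ x, ∀ i, A x i * f x = G x i := by
    filter_upwards [ae_all_iff.2 fun i => hG.ae_eq_zero_of_eq_zero hf_int hf_nonneg i] with x hx i
    rw [hA_eq]
    exact div_mul_cancel_of_imp (hx i)
  have hexpand : ∀ n, (fun x => cutoff n x * S x) =ᵐ[volume]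
      fun x => cutoff n x * V x - 2 / m * ∑ i, G x i * (cutoff n x * x.2 i) := by
    intro n
    filter_upwards [hAf] with x hx
    simp only [hS, hV, ← hx, ← Finset.sum_add_distrib, Finset.sum_mul, Finset.mul_sum,
      ← Finset.sum_sub_distrib]
    refine Finset.sum_congr rfl fun i _ => ?_
    field_simp
    ring
  set ε : ℕ → ℝ := fun n => ∑ i, ∫ x, f x * (x.2 i * pdP (cutoff n) x i) with hε
  have hε0 : Tendsto ε atTop (𝓝 0) := by
    simpa using tendsto_finsetSum (Finset.univ : Finset (Fin d)) fun i _ =>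
      tendsto_integral_mul_momentum_mul_pdP_cutoff hf_int i
  have hbound : ∀ n, ∫⁻ x, ENNReal.ofReal (cutoff n x * S x)
      ≤ (∫⁻ x, ENNReal.ofReal (V x)) + ENNReal.ofReal (2 / m * (d + ε n)) := by
    intro n
    have hsum : Integrable (fun x => 2 / m * ∑ i, G x i * (cutoff n x * x.2 i)) volume :=
      (integrable_finsetSum _ fun i _ => hGint n i).const_mul _
    have hcS : Integrable (fun x => cutoff n x * S x) volume :=
      ((hcVint n).sub hsum).congr (hexpand n).symm
    rw [← ofReal_integral_eq_lintegral_ofReal hcS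
      (ae_of_all _ fun x => mul_nonneg (cutoff_nonneg n x) (hS0 x)),
      ← ofReal_integral_eq_lintegral_ofReal hVint (ae_of_all _ hV0)]
    refine (ENNReal.ofReal_le_ofReal ?_).trans ENNReal.ofReal_add_le
    rw [integral_congr_ae (hexpand n), integral_sub (hcVint n) hsum, integral_const_mul,
      integral_finsetSum _ fun i _ => hGint n i, sub_eq_add_neg, ← mul_neg,
      ← Finset.sum_neg_distrib]
    refine add_le_add (integral_mono (hcVint n) hVint fun x =>
      mul_le_of_le_one_left (hV0 x) (cutoff_le_one n x))
      (mul_le_mul_of_nonneg_left ?_ (by positivity))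
    calc ∑ i, -∫ x, G x i * (cutoff n x * x.2 i)
        ≤ ∑ i : Fin d, (1 + ∫ x, f x * (x.2 i * pdP (cutoff n) x i)) :=
          Finset.sum_le_sum fun i _ =>
            hG.neg_integral_mul_cutoff_mul_momentum_le hf_int hf_nonneg hf_prob n i
      _ = d + ε n := by simp [hε, Finset.sum_add_distrib]
  have hlim : Tendsto
      (fun n => (∫⁻ x, ENNReal.ofReal (V x)) + ENNReal.ofReal (2 / m * (d + ε n))) atTop
      (𝓝 ((∫⁻ x, ENNReal.ofReal (V x)) + ENNReal.ofReal (2 * d / m))) := by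
    refine tendsto_const_nhds.add (ENNReal.tendsto_ofReal ?_)
    have h := (hε0.const_add (d : ℝ)).const_mul (2 / m)
    rwa [add_zero, div_mul_eq_mul_div] at h
  calc ∫⁻ x, ENNReal.ofReal (S x)
      = ∫⁻ x, liminf (fun n => ENNReal.ofReal (cutoff n x * S x)) atTop := by
        refine lintegral_congr fun x => (Tendsto.liminf_eq ?_).symm
        simpa using ENNReal.tendsto_ofReal ((tendsto_cutoff x).mul_const (S x))
    _ ≤ liminf (fun n => ∫⁻ x, ENNReal.ofReal (cutoff n x * S x)) atTop :=
        lintegral_liminf_le' fun n => ((hcm n).aemeasurable.mul hSm).ennreal_ofReal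
    _ ≤ liminf (fun n =>
          (∫⁻ x, ENNReal.ofReal (V x)) + ENNReal.ofReal (2 / m * (d + ε n))) atTop :=
        liminf_le_liminf (Eventually.of_forall hbound)
    _ = _ := hlim.liminf_eq

end
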